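/- For a bounded domain Ω ⊂ ℝ^d with smooth boundary, the ratio |Ω|^{1/d'} / |∂Ω| ≤ 1/(d·ω_d^{1/d}), where ω_d is the volume of the unit ball in ℝ^d and d' = d/(d−1). (This is a form of the isoperimetric inequality.) -/

import Mathlib

open MeasureTheory Filter
open scoped ENNReal Pointwise

/-- One-dimensional Brunn–Minkowski inequality for compact sets. -/
theorem IsCompact.volume_add_volume_le_volume_add {K L : Set ℝ} (hK : IsCompact K)
    (hL : IsCompact L) (hKne : K.Nonempty) (hLne : L.Nonempty) :
    volume K + volume L ≤ volume (K + L) := by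
  obtain ⟨a, haK, ha⟩ := hK.exists_isGreatest hKne
  obtain ⟨b, hbL, hb⟩ := hL.exists_isLeast hLne
  have hdisj : AEDisjoint volume ((fun x => x + b) '' K) ((fun x => a + x) '' L) := by
    refine measure_mono_null (t := {a + b}) ?_ (by simp)
    rintro _ ⟨⟨x, hx, rfl⟩, y, hy, hxy⟩
    have h₁ := ha hx
    have h₂ := hb hy
    simp only at hxy
    simp only [Set.mem_singleton_iff]
    linarith
  have hmeas : NullMeasurableSet ((fun x => a + x) '' L) :=
    (hL.image (by fun_prop)).measurableSet.nullMeasurableSet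
  calc volume K + volume L
      = volume ((fun x => x + b) '' K ∪ (fun x => a + x) '' L) := by
        rw [measure_union₀ hmeas hdisj]
        simp
    _ ≤ volume (K + L) := by
        refine measure_mono (Set.union_subset ?_ ?_)
        · rintro _ ⟨x, hx, rfl⟩
          exact Set.add_mem_add hx hbL
        · rintro _ ⟨x, hx, rfl⟩
          exact Set.add_mem_add haK hx

/-- One-dimensional Brunn–Minkowski inequality for measurable sets. -/
theorem MeasurableSet.volume_add_volume_le_volume_add {A B : Set ℝ} (hA : MeasurableSet A)
    (hB : MeasurableSet B) (hAne : A.Nonempty) (hBne : B.Nonempty) :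
    volume A + volume B ≤ volume (A + B) := by
  obtain ⟨a, ha⟩ := hAne
  obtain ⟨b, hb⟩ := hBne
  rw [hA.measure_eq_iSup_isCompact, hB.measure_eq_iSup_isCompact]
  simp only [iSup_and']
  refine ENNReal.biSup_add_biSup_le' ⟨∅, by simp⟩ ⟨∅, by simp⟩ ?_
  rintro K ⟨hKA, hK⟩ L ⟨hLB, hL⟩
  calc volume K + volume L ≤ volume (insert a K) + volume (insert b L) := by
        gcongr <;> simp
    _ ≤ volume (insert a K + insert b L) :=
        (hK.insert a).volume_add_volume_le_volume_add (hL.insert b) (by simp) (by simp)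
    _ ≤ volume (A + B) := by
        gcongr
        · exact Set.insert_subset ha hKA
        · exact Set.insert_subset hb hLB

theorem lintegral_eq_lintegral_volume_lt_of_le_one {f : ℝ → ℝ≥0∞} (hf : Measurable f)
    (hf1 : ∀ x, f x ≤ 1) :
    ∫⁻ x, f x = ∫⁻ r in Set.Ioi (0 : ℝ), volume {x | ENNReal.ofReal r < f x} := by
  have hfin : ∀ x, f x ≠ ∞ := fun x => ((hf1 x).trans_lt ENNReal.one_lt_top).ne
  calc ∫⁻ x, f x = ∫⁻ x, ENNReal.ofReal (f x).toReal := by simp [hfin]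
    _ = ∫⁻ r in Set.Ioi (0 : ℝ), volume {x | r < (f x).toReal} :=
        lintegral_eq_lintegral_meas_lt _ (ae_of_all _ fun x => ENNReal.toReal_nonneg)
          hf.ennreal_toReal.aemeasurable
    _ = ∫⁻ r in Set.Ioi (0 : ℝ), volume {x | ENNReal.ofReal r < f x} := by
        refine setLIntegral_congr_fun measurableSet_Ioi fun r hr => ?_
        simp only [ENNReal.ofReal_lt_iff_lt_toReal (le_of_lt hr) (hfin _)]

theorem lintegral_add_lintegral_le_of_iSup_eq_one {s t : ℝ} (hs : 0 < s) (ht : 0 < t)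
    (hst : s + t = 1) {f g h : ℝ → ℝ≥0∞} (hf : Measurable f) (hg : Measurable g)
    (hh : Measurable h) (hfsup : ⨆ x, f x = 1) (hgsup : ⨆ x, g x = 1)
    (hfgh : ∀ x y, f x ^ s * g y ^ t ≤ h (x + y)) :
    (∫⁻ x, f x) + ∫⁻ x, g x ≤ ∫⁻ x, h x := by
  have hf1 : ∀ x, f x ≤ 1 := fun x => hfsup ▸ le_iSup f x
  have hg1 : ∀ x, g x ≤ 1 := fun x => hgsup ▸ le_iSup g x
  have hlevel : ∀ r ∈ Set.Ioi (0 : ℝ), volume {x | ENNReal.ofReal r < f x} +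
      volume {x | ENNReal.ofReal r < g x} ≤ volume {x | ENNReal.ofReal r < min (h x) 1} := by
    intro r _
    rcases le_or_gt 1 (ENNReal.ofReal r) with hr1 | hr1
    · simp [fun x => ((hf1 x).trans hr1).not_gt, fun x => ((hg1 x).trans hr1).not_gt]
    have hfne : {x | ENNReal.ofReal r < f x}.Nonempty := by
      obtain ⟨x, hx⟩ := lt_iSup_iff.1 (hfsup.symm ▸ hr1)
      exact ⟨x, hx⟩
    have hgne : {x | ENNReal.ofReal r < g x}.Nonempty := by
      obtain ⟨x, hx⟩ := lt_iSup_iff.1 (hgsup.symm ▸ hr1)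
      exact ⟨x, hx⟩
    refine ((measurableSet_lt measurable_const hf).volume_add_volume_le_volume_add
      (measurableSet_lt measurable_const hg) hfne hgne).trans (measure_mono ?_)
    rintro _ ⟨x, hx, y, hy, rfl⟩
    simp only [Set.mem_ofPred_eq] at hx hy
    refine lt_min (lt_of_lt_of_le ?_ (hfgh x y)) hr1
    calc ENNReal.ofReal r = ENNReal.ofReal r ^ s * ENNReal.ofReal r ^ t := by
          rw [← ENNReal.rpow_add_of_nonneg _ _ hs.le ht.le, hst, ENNReal.rpow_one]
      _ < f x ^ s * g y ^ t :=
          ENNReal.mul_lt_mul (ENNReal.rpow_lt_rpow hx hs) (ENNReal.rpow_lt_rpow hy ht)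
  calc (∫⁻ x, f x) + ∫⁻ x, g x
      ≤ ∫⁻ r in Set.Ioi (0 : ℝ), (volume {x | ENNReal.ofReal r < f x} +
          volume {x | ENNReal.ofReal r < g x}) := by
        rw [lintegral_eq_lintegral_volume_lt_of_le_one hf hf1,
          lintegral_eq_lintegral_volume_lt_of_le_one hg hg1]
        exact le_lintegral_add _ _
    _ ≤ ∫⁻ r in Set.Ioi (0 : ℝ), volume {x | ENNReal.ofReal r < min (h x) 1} :=
        setLIntegral_mono' measurableSet_Ioi hlevel
    _ = ∫⁻ x, min (h x) 1 :=
        (lintegral_eq_lintegral_volume_lt_of_le_one (hh.min measurable_const)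
          fun x => min_le_right _ _).symm
    _ ≤ ∫⁻ x, h x := lintegral_mono fun x => min_le_left _ _

theorem ENNReal.weighted_mul_rpow_mul_rpow_le_add {s t : ℝ} (hs : 0 < s) (ht : 0 < t)
    (hst : s + t = 1) (a b : ℝ≥0∞) :
    ENNReal.ofReal (s ^ (-s) * t ^ (-t)) * (a ^ s * b ^ t) ≤ a + b := by
  have hconj : (s⁻¹).HolderConjugate t⁻¹ := by
    rw [Real.holderConjugate_iff]
    refine ⟨(one_lt_inv₀ hs).2 (by linarith), by simpa using hst⟩
  have hweight : ∀ {u : ℝ} (_ : 0 < u) (c : ℝ≥0∞),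
      ((c / ENNReal.ofReal u) ^ u) ^ u⁻¹ / ENNReal.ofReal u⁻¹ = c := by
    intro u hu c
    rw [ENNReal.rpow_rpow_inv hu.ne', ENNReal.ofReal_inv_of_pos hu, div_eq_mul_inv, inv_inv,
      ENNReal.div_mul_cancel (by simpa using hu) ENNReal.ofReal_ne_top]
  calc ENNReal.ofReal (s ^ (-s) * t ^ (-t)) * (a ^ s * b ^ t)
      = (a / ENNReal.ofReal s) ^ s * (b / ENNReal.ofReal t) ^ t := by
        rw [ENNReal.div_rpow_of_nonneg _ _ hs.le, ENNReal.div_rpow_of_nonneg _ _ ht.le,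
          ENNReal.ofReal_mul (by positivity), ← ENNReal.ofReal_rpow_of_pos hs,
          ← ENNReal.ofReal_rpow_of_pos ht, ENNReal.rpow_neg, ENNReal.rpow_neg, div_eq_mul_inv,
          div_eq_mul_inv]
        ring
    _ ≤ a + b := by
        simpa only [hweight hs, hweight ht] using
          ENNReal.young_inequality ((a / ENNReal.ofReal s) ^ s) ((b / ENNReal.ofReal t) ^ t) hconj

/-- Prékopa–Leindler inequality on the line, for functions bounded above. -/
theorem prekopa_leindler_real_of_iSup_ne_top {s t : ℝ} (hs : 0 < s) (ht : 0 < t)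
    (hst : s + t = 1) {f g h : ℝ → ℝ≥0∞} (hf : Measurable f) (hg : Measurable g)
    (hh : Measurable h) (hfsup : ⨆ x, f x ≠ ∞) (hgsup : ⨆ x, g x ≠ ∞)
    (hfgh : ∀ x y, f x ^ s * g y ^ t ≤ h (x + y)) :
    ENNReal.ofReal (s ^ (-s) * t ^ (-t)) * ((∫⁻ x, f x) ^ s * (∫⁻ x, g x) ^ t) ≤ ∫⁻ x, h x := by
  set F := ⨆ x, f x
  set G := ⨆ x, g x
  rcases eq_or_ne F 0 with hF0 | hF0
  · have hf0 : ∀ x, f x = 0 := ENNReal.iSup_eq_zero.1 hF0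
    simp [hf0, hs]
  rcases eq_or_ne G 0 with hG0 | hG0
  · have hg0 : ∀ x, g x = 0 := ENNReal.iSup_eq_zero.1 hG0
    simp [hg0, ht]
  have hFs0 : F ^ s ≠ 0 := by simp [hF0, hfsup]
  have hGt0 : G ^ t ≠ 0 := by simp [hG0, hgsup]
  have hFs : F ^ s ≠ ∞ := ENNReal.rpow_ne_top_of_nonneg hs.le hfsup
  have hGt : G ^ t ≠ ∞ := ENNReal.rpow_ne_top_of_nonneg ht.le hgsup
  have hsum : (∫⁻ x, f x / F) + ∫⁻ x, g x / G ≤ ∫⁻ x, h x / (F ^ s * G ^ t) := by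
    refine lintegral_add_lintegral_le_of_iSup_eq_one hs ht hst (hf.div_const _) (hg.div_const _)
      (hh.div_const _) ?_ ?_ fun x y => ?_
    · rw [← ENNReal.iSup_div, ENNReal.div_self hF0 hfsup]
    · rw [← ENNReal.iSup_div, ENNReal.div_self hG0 hgsup]
    · rw [ENNReal.div_rpow_of_nonneg _ _ hs.le, ENNReal.div_rpow_of_nonneg _ _ ht.le,
        ← ENNReal.mul_div_mul_comm (.inl hFs0) (.inl hFs)]
      gcongr
      exact hfgh x y
  simp only [div_eq_mul_inv] at hsum
  rw [lintegral_mul_const _ hf, lintegral_mul_const _ hg, lintegral_mul_const _ hh] at hsum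
  simp only [← div_eq_mul_inv] at hsum
  have hmean := (ENNReal.weighted_mul_rpow_mul_rpow_le_add hs ht hst _ _).trans hsum
  rw [ENNReal.div_rpow_of_nonneg _ _ hs.le, ENNReal.div_rpow_of_nonneg _ _ ht.le,
    ← ENNReal.mul_div_mul_comm (.inl hFs0) (.inl hFs), ← mul_div_assoc] at hmean
  rwa [ENNReal.div_le_iff (mul_ne_zero hFs0 hGt0) (ENNReal.mul_ne_top hFs hGt),
    ENNReal.div_mul_cancel (mul_ne_zero hFs0 hGt0) (ENNReal.mul_ne_top hFs hGt)] at hmean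

theorem ENNReal.iSup_rpow {ι : Sort*} {s : ℝ} (hs : 0 < s) (a : ι → ℝ≥0∞) :
    (⨆ i, a i) ^ s = ⨆ i, a i ^ s :=
  (ENNReal.orderIsoRpow s hs).map_iSup a

theorem lintegral_eq_iSup_lintegral_min_natCast {α : Type*} [MeasurableSpace α] {μ : Measure α}
    {f : α → ℝ≥0∞} (hf : Measurable f) :
    ∫⁻ x, f x ∂μ = ⨆ n : ℕ, ∫⁻ x, min (f x) n ∂μ := by
  rw [← lintegral_iSup (fun n => hf.min measurable_const)]
  · simp_rw [← inf_iSup_eq, ENNReal.iSup_natCast, inf_top_eq]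
  · exact fun m n hmn x => by dsimp only; gcongr

/-- **Prékopa–Leindler inequality** on the line. -/
theorem prekopa_leindler_real {s t : ℝ} (hs : 0 < s) (ht : 0 < t)
    (hst : s + t = 1) {f g h : ℝ → ℝ≥0∞} (hf : Measurable f) (hg : Measurable g)
    (hh : Measurable h) (hfgh : ∀ x y, f x ^ s * g y ^ t ≤ h (x + y)) :
    ENNReal.ofReal (s ^ (-s) * t ^ (-t)) * ((∫⁻ x, f x) ^ s * (∫⁻ x, g x) ^ t) ≤ ∫⁻ x, h x := by
  have hbdd : ∀ (k : ℝ → ℝ≥0∞) (n : ℕ), ⨆ x, min (k x) n ≠ ∞ := fun k n =>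
    ((iSup_le fun x => min_le_right _ _).trans_lt (ENNReal.natCast_lt_top n)).ne
  rw [lintegral_eq_iSup_lintegral_min_natCast hf, lintegral_eq_iSup_lintegral_min_natCast hg,
    ENNReal.iSup_rpow hs, ENNReal.iSup_rpow ht, ENNReal.iSup_mul, ENNReal.mul_iSup]
  refine iSup_le fun m => ?_
  rw [ENNReal.mul_iSup, ENNReal.mul_iSup]
  refine iSup_le fun n => ?_
  refine prekopa_leindler_real_of_iSup_ne_top hs ht hst (hf.min measurable_const)
    (hg.min measurable_const) hh (hbdd f m) (hbdd g n) fun x y => le_trans ?_ (hfgh x y)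
  gcongr <;> exact min_le_left _ _

/-- **Prékopa–Leindler inequality** on `ℝⁿ`. -/
theorem prekopa_leindler_pi {s t : ℝ} (hs : 0 < s) (ht : 0 < t) (hst : s + t = 1) (n : ℕ)
    {f g h : (Fin n → ℝ) → ℝ≥0∞} (hf : Measurable f) (hg : Measurable g)
    (hh : Measurable h) (hfgh : ∀ x y, f x ^ s * g y ^ t ≤ h (x + y)) :
    ENNReal.ofReal (s ^ (-s) * t ^ (-t)) ^ n * ((∫⁻ x, f x) ^ s * (∫⁻ x, g x) ^ t) ≤
      ∫⁻ x, h x := by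
  induction n with
  | zero =>
    have hvol : volume (Set.univ : Set (Fin 0 → ℝ)) = 1 := by
      rw [← Set.pi_univ, volume_pi_pi]
      simp
    simp only [lintegral_unique, hvol, mul_one, pow_zero, one_mul]
    convert hfgh default default
  | succ n ih =>
    set c := ENNReal.ofReal (s ^ (-s) * t ^ (-t)) with hc
    have hc0 : c ≠ 0 := by
      rw [hc]
      simp only [ne_eq, ENNReal.ofReal_eq_zero, not_le]
      positivity
    have hcn0 : c ^ n ≠ 0 := pow_ne_zero _ hc0
    have hcn : c ^ n ≠ ∞ := ENNReal.pow_ne_top ENNReal.ofReal_ne_top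
    have hcons : Measurable fun p : ℝ × (Fin n → ℝ) => (Fin.cons p.1 p.2 : Fin (n + 1) → ℝ) := by
      refine measurable_pi_lambda _ fun i => ?_
      refine Fin.cases ?_ (fun j => ?_) i
      · simpa using measurable_fst
      · simpa [Function.comp_def] using (measurable_pi_apply j).comp measurable_snd
    have hfubini : ∀ {k : (Fin (n + 1) → ℝ) → ℝ≥0∞}, Measurable k →
        ∫⁻ x, k x = ∫⁻ x₀ : ℝ, ∫⁻ x : Fin n → ℝ, k (Fin.cons x₀ x) := by
      intro k hk
      have hmp := (volume_preserving_piFinSuccAbove (fun _ : Fin (n + 1) => ℝ) 0).symm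
      rw [← hmp.lintegral_comp hk, Measure.volume_eq_prod, lintegral_prod _ (by fun_prop)]
      simp [MeasurableEquiv.piFinSuccAbove, Fin.insertNthEquiv]
    have hslice : ∀ {k : (Fin (n + 1) → ℝ) → ℝ≥0∞}, Measurable k →
        Measurable fun x₀ : ℝ => ∫⁻ x : Fin n → ℝ, k (Fin.cons x₀ x) := fun hk =>
      (hk.comp hcons).lintegral_prod_right'
    have hline := prekopa_leindler_real hs ht hst (hslice hf) (hslice hg)
      ((hslice hh).div_const (c ^ n)) fun x₀ y₀ => by
        rw [ENNReal.le_div_iff_mul_le (.inl hcn0) (.inl hcn), mul_comm]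
        refine ih (hf.comp (hcons.comp measurable_prodMk_left))
          (hg.comp (hcons.comp measurable_prodMk_left))
          (hh.comp (hcons.comp measurable_prodMk_left)) fun x y => ?_
        convert hfgh (Fin.cons x₀ x) (Fin.cons y₀ y) using 2
        ext i
        refine Fin.cases ?_ (fun j => ?_) i <;> simp
    simp only [div_eq_mul_inv] at hline
    rw [lintegral_mul_const _ (hslice hh), ← div_eq_mul_inv,
      ENNReal.le_div_iff_mul_le (.inl hcn0) (.inl hcn), ← hc] at hline
    rw [hfubini hf, hfubini hg, hfubini hh]
    refine le_trans (le_of_eq ?_) hline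
    ring

/-- Multiplicative Brunn–Minkowski inequality for open sets. -/
theorem IsOpen.volume_rpow_mul_volume_rpow_le {s t : ℝ} (hs : 0 < s) (ht : 0 < t)
    (hst : s + t = 1) {n : ℕ} {A B : Set (EuclideanSpace ℝ (Fin n))} (hA : IsOpen A)
    (hB : IsOpen B) :
    ENNReal.ofReal (s ^ (-s) * t ^ (-t)) ^ n * (volume A ^ s * volume B ^ t) ≤
      volume (A + B) := by
  have hAB : IsOpen (A + B) := hA.add_right
  have hmp := (EuclideanSpace.volume_preserving_symm_measurableEquiv_toLp (Fin n)).symm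
  have hvol : ∀ {C : Set (EuclideanSpace ℝ (Fin n))}, IsOpen C →
      volume C = ∫⁻ x : Fin n → ℝ, C.indicator 1 (WithLp.toLp 2 x) := by
    intro C hC
    rw [← lintegral_indicator_one hC.measurableSet]
    exact (hmp.lintegral_comp (measurable_one.indicator hC.measurableSet)).symm
  have hmeas : ∀ {C : Set (EuclideanSpace ℝ (Fin n))}, IsOpen C →
      Measurable fun x : Fin n → ℝ => (C.indicator 1 (WithLp.toLp 2 x) : ℝ≥0∞) := fun hC =>
    (measurable_one.indicator hC.measurableSet).comp hmp.measurable
  rw [hvol hA, hvol hB, hvol hAB]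
  refine prekopa_leindler_pi hs ht hst n (hmeas hA) (hmeas hB) (hmeas hAB) fun x y => ?_
  by_cases hx : WithLp.toLp 2 x ∈ A
  · by_cases hy : WithLp.toLp 2 y ∈ B
    · have hxy : WithLp.toLp 2 (x + y) ∈ A + B := Set.add_mem_add hx hy
      simp [hx, hy, -WithLp.toLp_add, hxy]
    · simp [hy, ht]
  · simp [hx, hs]

/-- **Brunn–Minkowski inequality** for open sets of finite positive measure. -/
theorem IsOpen.brunn_minkowski {n : ℕ} (hn : n ≠ 0) {A B : Set (EuclideanSpace ℝ (Fin n))}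
    (hA : IsOpen A) (hB : IsOpen B) (hA0 : 0 < volume.real A) (hB0 : 0 < volume.real B)
    (hAB : volume (A + B) ≠ ∞) :
    (volume.real A ^ (1 / (n : ℝ)) + volume.real B ^ (1 / (n : ℝ))) ^ n ≤
      volume.real (A + B) := by
  set a := volume.real A ^ (1 / (n : ℝ)) with ha
  set b := volume.real B ^ (1 / (n : ℝ)) with hb
  have ha0 : 0 < a := by positivity
  have hb0 : 0 < b := by positivity
  have hn' : (n : ℝ) ≠ 0 := by exact_mod_cast hn
  have han : volume.real A = a ^ n := by
    rw [ha, ← Real.rpow_natCast, ← Real.rpow_mul hA0.le, one_div_mul_cancel hn', Real.rpow_one]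
  have hbn : volume.real B = b ^ n := by
    rw [hb, ← Real.rpow_natCast, ← Real.rpow_mul hB0.le, one_div_mul_cancel hn', Real.rpow_one]
  have hs : 0 < a / (a + b) := by positivity
  have ht : 0 < b / (a + b) := by positivity
  have hst : a / (a + b) + b / (a + b) = 1 := by field_simp
  have hmul := ENNReal.toReal_mono hAB (hA.volume_rpow_mul_volume_rpow_le hs ht hst hB)
  rw [ENNReal.toReal_mul, ENNReal.toReal_mul, ENNReal.toReal_pow,
    ENNReal.toReal_ofReal (by positivity), ← ENNReal.toReal_rpow, ← ENNReal.toReal_rpow] at hmul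
  change _ * (volume.real A ^ _ * volume.real B ^ _) ≤ volume.real (A + B) at hmul
  refine le_trans (le_of_eq ?_) hmul
  rw [han, hbn, ← Real.rpow_natCast a, ← Real.rpow_natCast b, ← Real.rpow_mul ha0.le,
    ← Real.rpow_mul hb0.le, mul_comm (n : ℝ), mul_comm (n : ℝ), Real.rpow_mul ha0.le,
    Real.rpow_mul hb0.le, Real.rpow_natCast, Real.rpow_natCast, ← mul_pow, ← mul_pow]
  congr 1
  have hsplit : ∀ {u : ℝ} (_ : 0 < u),
      (u / (a + b)) ^ (-(u / (a + b))) * u ^ (u / (a + b)) = (a + b) ^ (u / (a + b)) := by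
    intro u hu
    have hab : 0 < a + b := by positivity
    rw [Real.rpow_neg (by positivity), ← Real.inv_rpow (by positivity),
      ← Real.mul_rpow (by positivity) hu.le]
    congr 1
    field_simp
  calc a + b = (a + b) ^ (a / (a + b)) * (a + b) ^ (b / (a + b)) := by
        rw [← Real.rpow_add (by positivity), hst, Real.rpow_one]
    _ = _ := by rw [← hsplit ha0, ← hsplit hb0]; ring

/-- Isoperimetric form: for a bounded domain `Ω ⊂ ℝ^d` (with smooth boundary, whose surface
measure `|∂Ω|` is realized as the Minkowski content of `Ω`),
`|Ω|^{1/d'}/|∂Ω| ≤ 1/(d ω_d^{1/d})`, where `ω_d` is the volume of the unit ball and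
`d' = d/(d−1)`. -/
theorem stmt_11
    (d : ℕ) (hd : 2 ≤ d)
    (Ω : Set (EuclideanSpace ℝ (Fin d))) (hΩopen : IsOpen Ω)
    (hΩbdd : Bornology.IsBounded Ω) (hΩne : Ω.Nonempty)
    (perim : ℝ) (hperim : 0 < perim)
    -- `|∂Ω|` is the (outer) Minkowski content of `Ω`
    (hMinkowski : Tendsto
      (fun ε : ℝ => ((volume (Metric.thickening ε Ω)).toReal - (volume Ω).toReal) / ε)
      (nhdsWithin 0 (Set.Ioi 0)) (nhds perim)) :
    (volume Ω).toReal ^ (1 / ((d : ℝ) / ((d : ℝ) - 1))) / perim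
      ≤ 1 / ((d : ℝ)
          * ((volume (Metric.ball (0 : EuclideanSpace ℝ (Fin d)) 1)).toReal) ^ (1 / (d : ℝ))) := by
  have hd0 : d ≠ 0 := by omega
  have hdpos : (0 : ℝ) < d := by positivity
  change volume.real Ω ^ _ / perim ≤
    1 / ((d : ℝ) * volume.real (Metric.ball (0 : EuclideanSpace ℝ (Fin d)) 1) ^ _)
  have hΩpos : 0 < volume.real Ω :=
    ENNReal.toReal_pos (hΩopen.measure_pos _ hΩne).ne' hΩbdd.measure_lt_top.ne
  have hballpos : ∀ {r : ℝ}, 0 < r →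
      0 < volume.real (Metric.ball (0 : EuclideanSpace ℝ (Fin d)) r) := fun hr =>
    ENNReal.toReal_pos (Metric.measure_ball_pos _ _ hr).ne' measure_ball_lt_top.ne
  have hω := hballpos one_pos
  set ω := volume.real (Metric.ball (0 : EuclideanSpace ℝ (Fin d)) 1)
  set w := ω ^ (1 / (d : ℝ))
  set a := volume.real Ω ^ (1 / (d : ℝ)) with ha
  have ha0 : 0 < a := by positivity
  have hw0 : 0 < w := by positivity
  have had : volume.real Ω = a ^ d := by
    rw [ha, ← Real.rpow_natCast, ← Real.rpow_mul hΩpos.le, one_div_mul_cancel hdpos.ne',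
      Real.rpow_one]
  have hquot : ∀ ε ∈ Set.Ioi (0 : ℝ), d * w * a ^ (d - 1) ≤
      ((volume (Metric.thickening ε Ω)).toReal - (volume Ω).toReal) / ε := by
    intro ε (hε : 0 < ε)
    have hball : volume.real (Metric.ball (0 : EuclideanSpace ℝ (Fin d)) ε) ^ (1 / (d : ℝ)) =
        ε * w := by
      rw [Measure.real, Measure.addHaar_ball_of_pos _ _ hε, ENNReal.toReal_mul,
        ENNReal.toReal_ofReal (by positivity), finrank_euclideanSpace_fin]
      change (ε ^ d * ω) ^ _ = _
      rw [Real.mul_rpow (by positivity) hω.le, ← Real.rpow_natCast, ← Real.rpow_mul hε.le,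
        mul_one_div_cancel hdpos.ne', Real.rpow_one]
    have hBM := hΩopen.brunn_minkowski hd0 Metric.isOpen_ball hΩpos (hballpos hε)
      (by rw [add_ball_zero]; exact hΩbdd.thickening.measure_lt_top.ne)
    rw [add_ball_zero, hball, ← ha] at hBM
    change _ ≤ (volume.real _ - volume.real _) / ε
    rw [le_div_iff₀ hε, had]
    have hbern : a ^ d + d * a ^ (d - 1) * (ε * w) ≤ (a + ε * w) ^ d :=
      pow_add_mul_le_add_pow ha0.le (by positivity) d
    linarith
  have hlim : d * w * a ^ (d - 1) ≤ perim :=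
    ge_of_tendsto hMinkowski (eventually_nhdsWithin_of_forall hquot)
  have hexp : volume.real Ω ^ (1 / ((d : ℝ) / ((d : ℝ) - 1))) = a ^ (d - 1) := by
    rw [ha, ← Real.rpow_natCast, ← Real.rpow_mul hΩpos.le, Nat.cast_sub (by omega)]
    congr 1
    simp [div_eq_inv_mul]
  rw [hexp, div_le_div_iff₀ hperim (by positivity)]
  linarith
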